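/- arXiv:2204.01770 — 2 statements merged into one kernel-verified Lean document; each statement's English description precedes it below -/
import Mathlib

section
/- Let 0 < s ≤ 1 and 0 < t ≤ 1, and let F ⊆ ℝ² be a circular (s,t)-Furstenberg set. Then the Hausdorff dimension of F satisfies dim_H F ≥ t/3 + s. -/
open scoped ENNReal
open MeasureTheory Metric Set

namespace CircFurst

/-- Hausdorff content as an outer measure. -/
noncomputable def content {X : Type*} [PseudoEMetricSpace X] (d : ℝ) (hd : 0 < d) : OuterMeasure X :=
  OuterMeasure.ofFunction (fun s => ediam s ^ d) (by simp [ENNReal.zero_rpow_of_pos hd])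

lemma content_le {X : Type*} [PseudoEMetricSpace X] (d : ℝ) (hd : 0 < d) (A : Set X) :
    content d hd A ≤ ediam A ^ d := OuterMeasure.ofFunction_le (m := fun s : Set X => ediam s ^ d) A

lemma content_lt_iff {X : Type*} [PseudoEMetricSpace X] {d : ℝ} (hd : 0 < d) {A : Set X} {ε : ℝ≥0∞}
    (h : content d hd A < ε) : ∃ U : ℕ → Set X, A ⊆ ⋃ n, U n ∧ ∑' n, ediam (U n) ^ d < ε := by
  unfold content at h
  rw [OuterMeasure.ofFunction_apply] at h
  simp only [iInf_lt_iff] at h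
  obtain ⟨U, hU, h⟩ := h
  exact ⟨U, hU, h⟩

lemma hausdorff_zero_of_content_zero {X : Type*} [EMetricSpace X] [MeasurableSpace X] [BorelSpace X]
    {d : ℝ} (hd : 0 < d) {A : Set X} (h : content d hd A = 0) : μH[d] A = 0 := by
  rw [Measure.hausdorffMeasure_apply]
  simp only [ENNReal.iSup_eq_zero]
  intro r hr
  refine le_antisymm (le_of_forall_gt fun ε hε => ?_) bot_le
  have hpos : 0 < min ε (r ^ d) := lt_min hε (ENNReal.rpow_pos_of_nonneg hr hd.le)
  rw [← h] at hpos
  obtain ⟨U, hU, hs⟩ := content_lt_iff hd hpos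
  simp only [iInf_lt_iff]
  refine ⟨U, hU, fun n => ?_, ?_⟩
  · have h1 : ediam (U n) ^ d ≤ r ^ d :=
      (ENNReal.le_tsum n).trans (hs.le.trans (min_le_right _ _))
    exact (ENNReal.rpow_le_rpow_iff hd).1 h1
  · refine lt_of_le_of_lt (ENNReal.tsum_le_tsum fun n => ?_) (hs.trans_le (min_le_left _ _))
    exact iSup_le fun _ => le_rfl

lemma content_zero_of_hausdorff_zero {X : Type*} [EMetricSpace X] [MeasurableSpace X] [BorelSpace X]
    {d : ℝ} (hd : 0 < d) {A : Set X} (h : μH[d] A = 0) : content d hd A = 0 := by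
  rw [Measure.hausdorffMeasure_apply] at h
  simp only [ENNReal.iSup_eq_zero] at h
  have h1 := h 1 one_pos
  refine le_antisymm (le_of_forall_gt fun ε hε => ?_) bot_le
  rw [← h1] at hε
  simp only [iInf_lt_iff] at hε
  obtain ⟨U, hU, -, hs⟩ := hε
  refine lt_of_le_of_lt ?_ hs
  unfold content
  rw [OuterMeasure.ofFunction_apply]
  refine (iInf₂_le U hU).trans (ENNReal.tsum_le_tsum fun n => ?_)
  rcases (U n).eq_empty_or_nonempty with h | h
  · simp [h, hd]
  · exact le_iSup (fun _ : (U n).Nonempty => ediam (U n) ^ d) h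

lemma exists_scale {u : ℝ} (hu : 0 < u) {a e : ℝ≥0∞} (ha : a ≤ 1) (he : e ≠ 0) :
    ∃ k : ℕ, a ≤ ENNReal.ofReal ((1/2 : ℝ) ^ k) ∧
      ENNReal.ofReal (((1/2 : ℝ) ^ k) ^ u) ≤ ENNReal.ofReal (2 ^ u) * a ^ u + e := by
  rcases eq_or_ne a 0 with rfl | h0
  · have ht : Filter.Tendsto (fun k : ℕ => ENNReal.ofReal (((1/2 : ℝ) ^ k) ^ u)) Filter.atTop
        (nhds 0) := by
      have h1 : Filter.Tendsto (fun k : ℕ => ((1/2 : ℝ) ^ k) ^ u) Filter.atTop (nhds 0) := by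
        have := (tendsto_pow_atTop_nhds_zero_of_lt_one (r := (1/2 : ℝ)) (by norm_num)
          (by norm_num)).rpow_const (p := u) (Or.inr hu.le)
        simpa [Real.zero_rpow hu.ne'] using this
      simpa using ENNReal.tendsto_ofReal h1
    obtain ⟨k, hk⟩ := (ht.eventually (gt_mem_nhds (pos_iff_ne_zero.2 he))).exists
    exact ⟨k, bot_le, hk.le.trans le_add_self⟩
  · have hat : a ≠ ∞ := ne_top_of_le_ne_top ENNReal.one_ne_top ha
    have hapos : 0 < a.toReal := ENNReal.toReal_pos h0 hat
    have ha1 : a.toReal ≤ 1 := by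
      have := ENNReal.toReal_mono ENNReal.one_ne_top ha
      simpa using this
    obtain ⟨k, hk1, hk2⟩ := exists_nat_pow_near_of_lt_one hapos ha1
      (show (0:ℝ) < 1/2 by norm_num) (by norm_num)
    refine ⟨k, ?_, ?_⟩
    · rw [← ENNReal.ofReal_toReal hat]
      exact ENNReal.ofReal_le_ofReal hk2
    · refine le_trans ?_ le_self_add
      rw [← ENNReal.ofReal_toReal hat, ENNReal.ofReal_rpow_of_pos hapos,
        ← ENNReal.ofReal_mul (by positivity), ← Real.mul_rpow (by norm_num) hapos.le]
      apply ENNReal.ofReal_le_ofReal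
      apply Real.rpow_le_rpow (by positivity) _ hu.le
      rw [pow_succ] at hk1
      linarith

lemma exists_cover {X : Type*} [PseudoEMetricSpace X] {u : ℝ} (hu : 0 < u) {F : Set X}
    (h : content u hu F = 0) {ε : ℝ} (hε : 0 < ε) :
    ∃ (U : ℕ → Set X) (k : ℕ → ℕ), F ⊆ ⋃ n, U n ∧
      (∀ n, ediam (U n) ≤ ENNReal.ofReal ((1/2 : ℝ) ^ k n)) ∧
      ∑' n, ENNReal.ofReal (((1/2 : ℝ) ^ k n) ^ u) ≤ ENNReal.ofReal ε := by
  have h2u : (0:ℝ) < 2 ^ u := by positivity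
  have hp : (0 : ℝ≥0∞) < min 1 (ENNReal.ofReal (ε / 2 / 2 ^ u)) := by
    apply lt_min one_pos
    rw [ENNReal.ofReal_pos]; positivity
  rw [← h] at hp
  obtain ⟨U, hU, hs⟩ := content_lt_iff hu hp
  obtain ⟨e, he, hes⟩ := ENNReal.exists_pos_sum_of_countable' (ε := ENNReal.ofReal (ε / 2))
    (by simpa using hε) ℕ
  have hd : ∀ n, ediam (U n) ≤ 1 := by
    intro n
    have h1 : ediam (U n) ^ u ≤ 1 ^ u := by
      rw [ENNReal.one_rpow]
      exact (ENNReal.le_tsum n).trans (hs.le.trans (min_le_left _ _))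
    exact (ENNReal.rpow_le_rpow_iff hu).1 h1
  choose k hk1 hk2 using fun n => exists_scale hu (hd n) (he n).ne'
  refine ⟨U, k, hU, hk1, ?_⟩
  calc _ ≤ ∑' n, (ENNReal.ofReal (2 ^ u) * ediam (U n) ^ u + e n) := ENNReal.tsum_le_tsum hk2
    _ = ENNReal.ofReal (2 ^ u) * ∑' n, ediam (U n) ^ u + ∑' n, e n := by
      rw [ENNReal.tsum_add, ENNReal.tsum_mul_left]
    _ ≤ ENNReal.ofReal (2 ^ u) * ENNReal.ofReal (ε / 2 / 2 ^ u) + ENNReal.ofReal (ε / 2) := by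
      gcongr
      exact hs.le.trans (min_le_right _ _)
    _ = ENNReal.ofReal ε := by
      rw [← ENNReal.ofReal_mul h2u.le, ← ENNReal.ofReal_add (by positivity) (by positivity)]
      congr 1
      field_simp
      ring

lemma pigeon {X : Type*} (μ : OuterMeasure X) {A : Set X} {B : ℕ → Set X} (hAB : A ⊆ ⋃ k, B k)
    {c q : ℝ} (hc : 0 < c) (hq0 : 0 < q) (hq1 : q < 1) (h : ENNReal.ofReal c ≤ μ A) :
    ∃ k, ENNReal.ofReal (c * (1 - q) / 2 * q ^ k) ≤ μ (B k) := by
  by_contra! hcon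
  have h1 : μ A ≤ ∑' k, ENNReal.ofReal (c * (1 - q) / 2 * q ^ k) :=
    (μ.mono hAB).trans ((measure_iUnion_le B).trans (ENNReal.tsum_le_tsum fun k => (hcon k).le))
  have hq : 0 < 1 - q := by linarith
  rw [← ENNReal.ofReal_tsum_of_nonneg (fun k => by positivity)
    ((summable_geometric_of_lt_one hq0.le hq1).mul_left _), tsum_mul_left,
    tsum_geometric_of_lt_one hq0.le hq1] at h1
  have h2 := h.trans h1
  rw [ENNReal.ofReal_le_ofReal_iff (by positivity)] at h2
  have : c * (1 - q) / 2 * (1 - q)⁻¹ = c / 2 := by field_simp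
  linarith

/-- Packing lemma. -/
lemma packing {Y τ : Type*} [PseudoMetricSpace Y] [DecidableEq τ] {t : ℝ} (ht : 0 < t)
    (A : Set Y) (T : Y → Finset τ) (B : Finset τ) (hTB : ∀ p ∈ A, T p ⊆ B) {M D : ℝ}
    (hM : 0 < M) (hD : 0 ≤ D)
    (hT : ∀ p ∈ A, M ≤ (T p).card)
    (hdist : ∀ p ∈ A, ∀ q ∈ A, ∀ x, x ∈ T p → x ∈ T q → dist p q ≤ D) :
    content t ht A ≤ ENNReal.ofReal (B.card / M * (2 * D) ^ t) := by
  classical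
  let good : Finset Y → Prop := fun P => (P : Set Y) ⊆ A ∧ (P : Set Y).PairwiseDisjoint T
  have hcard : ∀ P, good P → (P.card : ℝ) * M ≤ B.card := by
    intro P ⟨h1, h2⟩
    have : (P.biUnion T).card ≤ B.card := Finset.card_le_card
      (Finset.biUnion_subset.2 fun p hp => hTB p (h1 hp))
    rw [Finset.card_biUnion h2] at this
    calc (P.card : ℝ) * M = ∑ p ∈ P, M := by simp
      _ ≤ ∑ p ∈ P, ((T p).card : ℝ) := Finset.sum_le_sum fun p hp => hT p (h1 hp)
      _ ≤ B.card := by exact_mod_cast this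
  let S : Set ℕ := {n | ∃ P, good P ∧ P.card = n}
  have hSne : S.Nonempty := ⟨0, ∅, ⟨by simp, by simp⟩, rfl⟩
  have hSb : BddAbove S := by
    refine ⟨⌊(B.card : ℝ) / M⌋₊, ?_⟩
    rintro n ⟨P, hP, rfl⟩
    apply Nat.le_floor
    rw [le_div_iff₀ hM]
    exact hcard P hP
  obtain ⟨P, hP, hPn⟩ := Nat.sSup_mem hSne hSb
  have hmax : ∀ Q, good Q → Q.card ≤ P.card := fun Q hQ => hPn ▸ le_csSup hSb ⟨Q, hQ, rfl⟩
  have hcov : A ⊆ ⋃ p ∈ P, closedBall p D := by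
    intro q hq
    simp only [mem_iUnion, mem_closedBall, exists_prop]
    by_contra! hcon
    have hqP : q ∉ P := fun h => by
      have := hcon q h
      rw [dist_self] at this
      linarith
    have : good (insert q P) := by
      refine ⟨?_, ?_⟩
      · rw [Finset.coe_insert]
        exact insert_subset hq hP.1
      · rw [Finset.coe_insert]
        refine hP.2.insert fun p hp _ => ?_
        rw [Finset.disjoint_left]
        intro x hx hx'
        exact absurd (hdist q hq p (hP.1 hp) x hx hx') (not_le.2 (hcon p hp))
    have h2 := hmax _ this
    rw [Finset.card_insert_of_notMem hqP] at h2
    omega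
  calc content t ht A ≤ content t ht (⋃ p ∈ P, closedBall p D) := (content t ht).mono hcov
    _ ≤ ∑ p ∈ P, content t ht (closedBall p D) := measure_biUnion_finset_le P _
    _ ≤ ∑ p ∈ P, ENNReal.ofReal ((2 * D) ^ t) := by
      refine Finset.sum_le_sum fun p _ => (content_le t ht _).trans ?_
      rw [← ENNReal.ofReal_rpow_of_nonneg (by positivity) ht.le]
      refine ENNReal.rpow_le_rpow ?_ ht.le
      refine ediam_le_of_forall_dist_le fun x hx y hy => ?_
      have := dist_triangle_right x y p
      rw [mem_closedBall] at hx hy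
      linarith
    _ = ENNReal.ofReal (P.card * (2 * D) ^ t) := by
      rw [Finset.sum_const, nsmul_eq_mul, ENNReal.ofReal_mul (by positivity),
        ENNReal.ofReal_natCast]
    _ ≤ _ := by
      apply ENNReal.ofReal_le_ofReal
      gcongr
      rw [le_div_iff₀ hM]
      exact hcard P hP

end CircFurst

namespace CircFurst

lemma det_aux {v1 v2 w1 w2 c1 c2 r ρ R : ℝ} (hr : c1^2 + c2^2 = r^2)
    (hv : 2 * (c1 * v1 + c2 * v2) = v1^2 + v2^2) (hw : 2 * (c1 * w1 + c2 * w2) = w1^2 + w2^2)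
    (hρ : 0 < ρ) (hv' : ρ^2 ≤ v1^2 + v2^2) (hw' : ρ^2 ≤ w1^2 + w2^2)
    (hvw : ρ^2 ≤ (v1 - w1)^2 + (v2 - w2)^2) (hr0 : 0 ≤ r) (hR : r ≤ R) :
    ρ^3 ≤ 2 * R * |v1 * w2 - v2 * w1| := by
  have h1 : 2 * (v1 * w2 - v2 * w1) * c1 = (v1^2+v2^2) * w2 - (w1^2+w2^2) * v2 := by
    linear_combination w2 * hv - v2 * hw
  have h2 : 2 * (v1 * w2 - v2 * w1) * c2 = (w1^2+w2^2) * v1 - (v1^2+v2^2) * w1 := by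
    linear_combination v1 * hw - w1 * hv
  have key : (2 * r * |v1 * w2 - v2 * w1|)^2
      = (v1^2+v2^2) * (w1^2+w2^2) * ((v1 - w1)^2 + (v2 - w2)^2) := by
    rw [mul_pow, sq_abs, mul_pow, ← hr]
    calc _ = (2 * (v1 * w2 - v2 * w1) * c1)^2 + (2 * (v1 * w2 - v2 * w1) * c2)^2 := by ring
      _ = _ := by rw [h1, h2]; ring
  have h3 : (ρ^3)^2 ≤ (2 * r * |v1 * w2 - v2 * w1|)^2 := by
    rw [key]
    calc (ρ^3)^2 = ρ^2 * ρ^2 * ρ^2 := by ring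
      _ ≤ _ := by gcongr
  have h4 := (pow_le_pow_iff_left₀ (by positivity) (by positivity) two_ne_zero).1 h3
  refine h4.trans ?_
  gcongr

lemma lin_aux {v1 v2 w1 w2 x1 x2 m V : ℝ} (h1 : |x1 * v1 + x2 * v2| ≤ m)
    (h2 : |x1 * w1 + x2 * w2| ≤ m) (hv : v1^2 + v2^2 ≤ V^2) (hw : w1^2 + w2^2 ≤ V^2)
    (hV : 0 ≤ V) (hm : 0 ≤ m) :
    |v1 * w2 - v2 * w1| * √(x1^2 + x2^2) ≤ 2 * V * m := by
  rw [← Real.sqrt_sq_eq_abs, ← Real.sqrt_mul (sq_nonneg _)]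
  apply Real.sqrt_le_iff.2 ⟨by positivity, ?_⟩
  set a := x1 * v1 + x2 * v2
  set b := x1 * w1 + x2 * w2
  have e : (v1 * w2 - v2 * w1)^2 * (x1^2 + x2^2) = (a * w1 - b * v1)^2 + (a * w2 - b * v2)^2 := by
    simp only [a, b]; ring
  rw [e]
  have ha : a^2 ≤ m^2 := sq_le_sq' (abs_le.1 h1).1 (abs_le.1 h1).2
  have hb : b^2 ≤ m^2 := sq_le_sq' (abs_le.1 h2).1 (abs_le.1 h2).2
  have i1 : a^2 * (w1^2 + w2^2) ≤ m^2 * V^2 := by gcongr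
  have i2 : b^2 * (v1^2 + v2^2) ≤ m^2 * V^2 := by gcongr
  nlinarith [sq_nonneg (a * w1 + b * v1), sq_nonneg (a * w2 + b * v2)]

lemma three_points {x x' a b c a' b' c' : EuclideanSpace ℝ (Fin 2)} {r r' δ ρ R : ℝ}
    (hr0 : 0 < r) (hr0' : 0 < r') (hr : r ≤ R) (hr' : r' ≤ R) (hδ1 : δ ≤ R) (hδ : 0 < δ) (hρ : 0 < ρ)
    (ha : dist a x = r) (hb : dist b x = r) (hc : dist c x = r)
    (ha' : dist a' x' = r') (hb' : dist b' x' = r') (hc' : dist c' x' = r')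
    (haa : dist a a' ≤ δ) (hbb : dist b b' ≤ δ) (hcc : dist c c' ≤ δ)
    (hab : ρ ≤ dist a b) (hac : ρ ≤ dist a c) (hbc : ρ ≤ dist b c) :
    dist (x, r) (x', r') ≤ 24 * R^3 * δ / ρ^3 + δ := by
  have hR : 0 < R := hr0.trans_le hr
  have dsq : ∀ y z : EuclideanSpace ℝ (Fin 2), dist y z ^ 2 = (y 0 - z 0)^2 + (y 1 - z 1)^2 := by
    intro y z
    rw [EuclideanSpace.dist_eq, Real.sq_sqrt (by positivity)]
    simp [Real.dist_eq, sq_abs]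
  have near : ∀ y y', dist y' x' = r' → dist y y' ≤ δ → |dist y x' ^ 2 - r' ^ 2| ≤ 3 * R * δ := by
    intro y y' h1 h2
    have h3 := dist_triangle y y' x'
    have h4 := dist_triangle_left y' x' y
    have h5 : |dist y x' - r'| ≤ δ := abs_le.2 ⟨by linarith, by linarith⟩
    have h6 : dist y x' + r' ≤ 3 * R := by linarith
    calc |dist y x' ^ 2 - r' ^ 2| = (dist y x' + r') * |dist y x' - r'| := by
          rw [sq_sub_sq, abs_mul, abs_of_nonneg (a := dist y x' + r') (by positivity)]
      _ ≤ _ := by gcongr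
  have na := near a a' ha' haa
  have nb := near b b' hb' hbb
  have nc := near c c' hc' hcc
  have sa := dsq a x; have sb := dsq b x; have sc := dsq c x
  rw [ha] at sa; rw [hb] at sb; rw [hc] at sc
  have dab := dsq a b; have dac := dsq a c; have dbc := dsq b c
  have q1 : ρ^2 ≤ dist a b^2 := by gcongr
  have q2 : ρ^2 ≤ dist a c^2 := by gcongr
  have q3 : ρ^2 ≤ dist b c^2 := by gcongr
  have tb : dist a b ≤ 2 * R := by have := dist_triangle_right a b x; linarith
  have tc : dist a c ≤ 2 * R := by have := dist_triangle_right a c x; linarith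
  have p1 : dist a b^2 ≤ (2*R)^2 := by gcongr
  have p2 : dist a c^2 ≤ (2*R)^2 := by gcongr
  have hdet := det_aux (v1 := b 0 - a 0) (v2 := b 1 - a 1) (w1 := c 0 - a 0) (w2 := c 1 - a 1)
    (c1 := x 0 - a 0) (c2 := x 1 - a 1) (r := r) (ρ := ρ) (R := R)
    (by linarith) (by linarith) (by linarith) hρ (by linarith) (by linarith) (by linarith)
    hr0.le hr
  rw [dsq] at na nb nc
  have hlin := lin_aux (v1 := b 0 - a 0) (v2 := b 1 - a 1) (w1 := c 0 - a 0) (w2 := c 1 - a 1)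
    (x1 := x 0 - x' 0) (x2 := x 1 - x' 1) (m := 3 * R * δ) (V := 2 * R)
    (by rw [abs_le] at *; constructor <;> linarith)
    (by rw [abs_le] at *; constructor <;> linarith) (by linarith) (by linarith)
    (by positivity) (by positivity)
  have hxx : √((x 0 - x' 0)^2 + (x 1 - x' 1)^2) = dist x x' := by
    rw [← dsq, Real.sqrt_sq dist_nonneg]
  rw [hxx] at hlin
  have hfin : dist x x' ≤ 24 * R^3 * δ / ρ^3 := by
    rw [le_div_iff₀ (by positivity)]
    calc dist x x' * ρ^3 ≤ dist x x' * (2 * R * |(b 0 - a 0) * (c 1 - a 1) - (b 1 - a 1) * (c 0 - a 0)|) := by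
          gcongr
      _ = 2 * R * (|(b 0 - a 0) * (c 1 - a 1) - (b 1 - a 1) * (c 0 - a 0)| * dist x x') := by ring
      _ ≤ 2 * R * (2 * (2 * R) * (3 * R * δ)) := by gcongr
      _ = _ := by ring
  rw [Prod.dist_eq]
  apply max_le
  · simp only; linarith
  · simp only [Real.dist_eq]
    have e1 := dist_triangle4 a a' x' x
    have e2 := dist_triangle4 a' a x x'
    rw [dist_comm a' a] at e2
    rw [dist_comm x' x] at e1
    rw [abs_le]; constructor <;> linarith

lemma triples {X : Type*} [PseudoMetricSpace X] (I : Finset ℕ) (U : ℕ → Set X) (A : Set X) {ρ M : ℝ}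
    (hM : 0 < M) (P : ℕ × ℕ × ℕ → Prop) [DecidablePred P]
    (hP : ∀ i j k, ∀ a ∈ U i ∩ A, ∀ b ∈ U j ∩ A, ∀ c ∈ U k ∩ A, ρ ≤ dist a b → ρ ≤ dist a c →
      ρ ≤ dist b c → P (i, j, k))
    (h : ∀ x y, ∃ J ⊆ I, M ≤ J.card ∧ ∀ i ∈ J, ∃ a ∈ U i ∩ A, ρ ≤ dist x a ∧ ρ ≤ dist y a)
    [Nonempty X] :
    M ^ 3 ≤ ((I ×ˢ I ×ˢ I).filter P).card := by
  classical
  choose J hJI hJc hJ using h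
  choose! f hf using hJ
  let x0 : X := Classical.arbitrary X
  let a : ℕ → X := fun i => f x0 x0 i
  let b : ℕ → ℕ → X := fun i j => f (a i) (a i) j
  let S : Finset (Σ _ : ℕ, Σ _ : ℕ, ℕ) :=
    (J x0 x0).sigma fun i => (J (a i) (a i)).sigma fun j => J (a i) (b i j)
  have hS : M ^ 3 ≤ (S.card : ℝ) := by
    simp only [S, Finset.card_sigma]
    push_cast
    calc M ^ 3 = M * (M * M) := by ring
      _ ≤ (J x0 x0).card * (M * M) := by gcongr; exact hJc _ _
      _ = ∑ i ∈ J x0 x0, M * M := by simp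
      _ ≤ _ := by
        refine Finset.sum_le_sum fun i _ => ?_
        calc M * M ≤ (J (a i) (a i)).card * M := by gcongr; exact hJc _ _
          _ = ∑ j ∈ J (a i) (a i), M := by simp
          _ ≤ _ := Finset.sum_le_sum fun j _ => hJc _ _
  refine hS.trans ?_
  norm_cast
  refine Finset.card_le_card_of_injOn (fun z => (z.1, z.2.1, z.2.2)) ?_ ?_
  · rintro ⟨i, j, k⟩ hz
    simp only [S, Finset.coe_sigma, Finset.mem_coe, mem_sigma_iff] at hz
    obtain ⟨hi, hj, hk⟩ := hz
    simp only [Finset.coe_filter, Finset.mem_product, mem_ofPred_eq]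
    refine ⟨⟨hJI _ _ hi, hJI _ _ hj, hJI _ _ hk⟩, ?_⟩
    have h1 := hf _ _ _ hi
    have h2 := hf _ _ _ hj
    have h3 := hf _ _ _ hk
    exact hP i j k _ h1.1 _ h2.1 _ h3.1 h2.2.1 h3.2.1 h3.2.2
  · rintro ⟨i, j, k⟩ _ ⟨i', j', k'⟩ _ h
    simp only [Prod.mk.injEq] at h
    obtain ⟨rfl, rfl, rfl⟩ := h
    rfl

end CircFurst

namespace CircFurst

lemma exists_J {X : Type*} [PseudoMetricSpace X] {s : ℝ} (hs : 0 < s) (I : Finset ℕ) (U : ℕ → Set X)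
    (A : Set X) {δ ρ c : ℝ} (hδ : 0 < δ) (hρ : 0 < ρ) (hA : A ⊆ ⋃ i ∈ I, U i)
    (hU : ∀ i ∈ I, ediam (U i) ≤ ENNReal.ofReal δ) (hc : ENNReal.ofReal c ≤ content s hs A)
    (hρc : 4 * (2 * ρ) ^ s ≤ c) (x y : X) :
    ∃ J ⊆ I, c / 2 / δ ^ s ≤ J.card ∧ ∀ i ∈ J, ∃ a ∈ U i ∩ A, ρ ≤ dist x a ∧ ρ ≤ dist y a := by
  classical
  refine ⟨I.filter fun i => ∃ a ∈ U i ∩ A, ρ ≤ dist x a ∧ ρ ≤ dist y a, Finset.filter_subset _ _,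
    ?_, fun i hi => (Finset.mem_filter.1 hi).2⟩
  set J := I.filter fun i => ∃ a ∈ U i ∩ A, ρ ≤ dist x a ∧ ρ ≤ dist y a with hJ
  have hsub : A ⊆ (ball x ρ ∪ ball y ρ) ∪ ⋃ i ∈ J, U i := by
    intro a ha
    by_cases h1 : a ∈ ball x ρ ∪ ball y ρ
    · exact Or.inl h1
    · right
      have h2 := hA ha
      simp only [mem_iUnion, exists_prop] at h2 ⊢
      obtain ⟨i, hi, hai⟩ := h2
      simp only [mem_union, mem_ball, not_or, not_lt] at h1
      rw [dist_comm a x, dist_comm a y] at h1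
      exact ⟨i, Finset.mem_filter.2 ⟨hi, a, ⟨hai, ha⟩, h1⟩, hai⟩
  have hball : ∀ z : X, content s hs (ball z ρ) ≤ ENNReal.ofReal ((2 * ρ) ^ s) := by
    intro z
    refine (content_le s hs _).trans ?_
    rw [← ENNReal.ofReal_rpow_of_nonneg (by positivity) hs.le]
    refine ENNReal.rpow_le_rpow ?_ hs.le
    refine ediam_le_of_forall_dist_le fun x hx y hy => ?_
    have := dist_triangle_right x y z
    rw [mem_ball] at hx hy
    linarith
  have hUi : ∀ i ∈ J, content s hs (U i) ≤ ENNReal.ofReal (δ ^ s) := by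
    intro i hi
    refine (content_le s hs _).trans ?_
    rw [← ENNReal.ofReal_rpow_of_nonneg (by positivity) hs.le]
    exact ENNReal.rpow_le_rpow (hU i (Finset.mem_filter.1 hi).1) hs.le
  have hmain : ENNReal.ofReal c ≤
      ENNReal.ofReal ((2 * ρ) ^ s + (2 * ρ) ^ s + J.card * δ ^ s) := by
    calc ENNReal.ofReal c ≤ content s hs A := hc
      _ ≤ content s hs ((ball x ρ ∪ ball y ρ) ∪ ⋃ i ∈ J, U i) := (content s hs).mono hsub
      _ ≤ content s hs (ball x ρ) + content s hs (ball y ρ) + ∑ i ∈ J, content s hs (U i) :=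
        (measure_union_le _ _).trans (add_le_add (measure_union_le _ _)
          (measure_biUnion_finset_le J _))
      _ ≤ ENNReal.ofReal ((2 * ρ) ^ s) + ENNReal.ofReal ((2 * ρ) ^ s) +
          ∑ i ∈ J, ENNReal.ofReal (δ ^ s) :=
        add_le_add (add_le_add (hball x) (hball y)) (Finset.sum_le_sum hUi)
      _ = _ := by
        rw [Finset.sum_const, nsmul_eq_mul, ENNReal.ofReal_add (by positivity) (by positivity),
          ENNReal.ofReal_add (by positivity) (by positivity), ENNReal.ofReal_mul (by positivity),
          ENNReal.ofReal_natCast]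
  rw [ENNReal.ofReal_le_ofReal_iff (by positivity)] at hmain
  rw [div_le_iff₀ (by positivity)]
  linarith

lemma scale_bound {s t : ℝ} (hs : 0 < s) (ht : 0 < t) (I : Finset ℕ)
    (U : ℕ → Set (EuclideanSpace ℝ (Fin 2))) (K : Set (EuclideanSpace ℝ (Fin 2) × ℝ))
    {δ ρ c R : ℝ} (hδ : 0 < δ) (hδR : δ ≤ R) (hρ : 0 < ρ) (hc : 0 < c) (hρc : 4 * (2 * ρ) ^ s ≤ c)
    (hU : ∀ i ∈ I, ediam (U i) ≤ ENNReal.ofReal δ)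
    (hK0 : ∀ p ∈ K, 0 < p.2) (hKR : ∀ p ∈ K, p.2 ≤ R)
    (hK : ∀ p ∈ K, ENNReal.ofReal c ≤ content s hs ((⋃ i ∈ I, U i) ∩ sphere p.1 p.2)) :
    content t ht K ≤ ENNReal.ofReal ((I.card : ℝ) ^ 3 / (c / 2 / δ ^ s) ^ 3 *
      (2 * (24 * R ^ 3 * δ / ρ ^ 3 + δ)) ^ t) := by
  classical
  let P : EuclideanSpace ℝ (Fin 2) × ℝ → ℕ × ℕ × ℕ → Prop := fun p z =>
    ∃ a ∈ U z.1 ∩ sphere p.1 p.2, ∃ b ∈ U z.2.1 ∩ sphere p.1 p.2, ∃ d ∈ U z.2.2 ∩ sphere p.1 p.2,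
      ρ ≤ dist a b ∧ ρ ≤ dist a d ∧ ρ ≤ dist b d
  have hR : 0 < R := hδ.trans_le hδR
  have hcard : ((I ×ˢ I ×ˢ I).card : ℝ) = (I.card : ℝ) ^ 3 := by
    simp only [Finset.card_product]; push_cast; ring
  rw [← hcard]
  refine packing ht K (fun p => (I ×ˢ I ×ˢ I).filter (P p)) (I ×ˢ I ×ˢ I)
    (fun p _ => Finset.filter_subset _ _) (by positivity) (by positivity) ?_ ?_
  · intro p hp
    refine triples I U ((⋃ i ∈ I, U i) ∩ sphere p.1 p.2) (ρ := ρ) (by positivity) (P p) ?_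
      (exists_J hs I U _ hδ hρ inter_subset_left hU (hK p hp) hρc)
    intro i j k a ha b hb d hd h1 h2 h3
    exact ⟨a, ⟨ha.1, ha.2.2⟩, b, ⟨hb.1, hb.2.2⟩, d, ⟨hd.1, hd.2.2⟩, h1, h2, h3⟩
  · rintro ⟨x, r⟩ hp ⟨x', r'⟩ hq ⟨i, j, k⟩ h1 h2
    rw [Finset.mem_filter] at h1 h2
    obtain ⟨hI, a, ha, b, hb, d, hd, hab, had, hbd⟩ := h1
    obtain ⟨-, a', ha', b', hb', d', hd', -⟩ := h2
    simp only [Finset.mem_product] at hI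
    have hdU : ∀ i ∈ I, ∀ y ∈ U i, ∀ z ∈ U i, dist y z ≤ δ := by
      intro i hi y hy z hz
      have := (edist_le_ediam_of_mem hy hz).trans (hU i hi)
      rw [edist_dist, ENNReal.ofReal_le_ofReal_iff hδ.le] at this
      exact this
    exact three_points (hK0 _ hp) (hK0 _ hq) (hKR _ hp) (hKR _ hq) hδR hδ hρ
      ha.2 hb.2 hd.2 ha'.2 hb'.2 hd'.2 (hdU i hI.1 _ ha.1 _ ha'.1) (hdU j hI.2.1 _ hb.1 _ hb'.1)
      (hdU k hI.2.2 _ hd.1 _ hd'.1) hab had hbd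

lemma numerics {s t u η δ C1 C2 R N ε : ℝ} (hs : 0 < s) (ht : 0 < t)
    (hη : 0 < η) (hηe : η * (4 + 3 * t / s) = 3 * s + t - 3 * u)
    (hδ : 0 < δ) (hδ1 : δ ≤ 1) (hC1 : 0 < C1) (hC11 : C1 ≤ 1) (hR : 1 ≤ R) (hN0 : 0 ≤ N)
    (hN : N * δ ^ u ≤ ε)
    (h : C2 * δ ^ η ≤ N ^ 3 / ((C1 * δ ^ η) / 2 / δ ^ s) ^ 3 *
      (2 * (24 * R ^ 3 * δ / ((C1 * δ ^ η / 4) ^ (1 / s) / 2) ^ 3 + δ)) ^ t) :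
    C2 ≤ ε ^ 3 * (8 / C1 ^ 3 * (50 * R ^ 3 / ((C1 / 4) ^ (1 / s) / 2) ^ 3) ^ t) := by
  set κ := (C1 / 4) ^ (1 / s) / 2 with hκ
  have hκ0 : 0 < κ := by positivity
  have hκ1 : κ ≤ 1 := by
    have : (C1 / 4) ^ (1 / s) ≤ 1 := Real.rpow_le_one (by positivity) (by linarith) (by positivity)
    rw [hκ]; linarith
  have hρ : (C1 * δ ^ η / 4) ^ (1 / s) / 2 = κ * δ ^ (η / s) := by
    rw [show C1 * δ ^ η / 4 = (C1 / 4) * δ ^ η by ring, Real.mul_rpow (by positivity) (by positivity),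
      ← Real.rpow_mul hδ.le, hκ, mul_one_div]
    ring
  rw [hρ] at h
  have hd1 : δ ^ (η / s) ≤ 1 := Real.rpow_le_one hδ.le hδ1 (by positivity)
  have hρ1 : (κ * δ ^ (η / s)) ^ 3 ≤ 1 := by
    apply pow_le_one₀ (by positivity)
    exact mul_le_one₀ hκ1 (by positivity) hd1
  have hD : 2 * (24 * R ^ 3 * δ / (κ * δ ^ (η / s)) ^ 3 + δ) ≤
      (50 * R ^ 3 / κ ^ 3) * δ ^ (1 - 3 * (η / s)) := by
    have e1 : δ ≤ R ^ 3 * δ / (κ * δ ^ (η / s)) ^ 3 := by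
      rw [le_div_iff₀ (by positivity)]
      have : 1 ≤ R ^ 3 := one_le_pow₀ hR
      calc δ * (κ * δ ^ (η / s)) ^ 3 ≤ δ * 1 := by gcongr
        _ = 1 * δ := by ring
        _ ≤ R ^ 3 * δ := by gcongr
    have e2 : δ ^ (1 - 3 * (η / s)) = δ / (δ ^ (η / s)) ^ 3 := by
      rw [Real.rpow_sub hδ, Real.rpow_one, ← Real.rpow_natCast (δ ^ (η / s)), ← Real.rpow_mul hδ.le]
      congr 2
      push_cast; ring
    rw [e2]
    calc _ ≤ 2 * (24 * R ^ 3 * δ / (κ * δ ^ (η / s)) ^ 3 + R ^ 3 * δ / (κ * δ ^ (η / s)) ^ 3) := by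
          gcongr
      _ = _ := by
        rw [mul_pow]; field_simp; ring
  have hN' : N ≤ ε * δ ^ (-u) := by
    rw [Real.rpow_neg hδ.le, ← div_eq_mul_inv, le_div_iff₀ (by positivity)]
    exact hN
  have hε : 0 ≤ ε := le_trans (by positivity) hN
  have h2 : C2 * δ ^ η ≤ (ε * δ ^ (-u)) ^ 3 / ((C1 * δ ^ η) / 2 / δ ^ s) ^ 3 *
      ((50 * R ^ 3 / κ ^ 3) * δ ^ (1 - 3 * (η / s))) ^ t := by
    refine h.trans ?_
    gcongr
  have h3 : (ε * δ ^ (-u)) ^ 3 / ((C1 * δ ^ η) / 2 / δ ^ s) ^ 3 *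
      ((50 * R ^ 3 / κ ^ 3) * δ ^ (1 - 3 * (η / s))) ^ t =
      (ε ^ 3 * (8 / C1 ^ 3 * (50 * R ^ 3 / κ ^ 3) ^ t)) * δ ^ η := by
    have p3 : ∀ a : ℝ, (δ ^ a) ^ 3 = δ ^ (3 * a) := by
      intro a
      rw [← Real.rpow_natCast (δ ^ a), ← Real.rpow_mul hδ.le]
      congr 1; push_cast; ring
    have hexp : δ ^ η = δ ^ (3 * (-u)) / δ ^ (3 * η) * δ ^ (3 * s) * δ ^ ((1 - 3 * (η / s)) * t) := by
      rw [← Real.rpow_sub hδ, ← Real.rpow_add hδ, ← Real.rpow_add hδ]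
      congr 1
      have : η * (3 * t / s) = 3 * (η / s) * t := by ring
      linarith
    rw [Real.mul_rpow (by positivity) (by positivity), ← Real.rpow_mul hδ.le]
    conv_rhs => rw [hexp]
    simp only [mul_pow, div_pow, p3]
    field_simp
    ring
  rw [h3] at h2
  exact le_of_mul_le_mul_right h2 (by positivity)

lemma core {s t u c R : ℝ} (hs : 0 < s) (ht : 0 < t) (hu : 0 < u) (hut : u < t / 3 + s)
    (F : Set (EuclideanSpace ℝ (Fin 2))) (K : Set (EuclideanSpace ℝ (Fin 2) × ℝ))
    (hF : content u hu F = 0) (hK : content t ht K ≠ 0) (hR : 1 ≤ R) (hc : 0 < c) (hc1 : c ≤ 1)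
    (hK0 : ∀ p ∈ K, 0 < p.2) (hKR : ∀ p ∈ K, p.2 ≤ R)
    (hKc : ∀ p ∈ K, ENNReal.ofReal c ≤ content s hs (F ∩ sphere p.1 p.2)) : False := by
  obtain ⟨c', hc'0, hc'⟩ : ∃ c' : ℝ, 0 < c' ∧ ENNReal.ofReal c' ≤ content t ht K := by
    rcases eq_or_ne (content t ht K) ∞ with h | h
    · exact ⟨1, one_pos, by rw [h]; exact le_top⟩
    · exact ⟨_, ENNReal.toReal_pos hK h, by rw [ENNReal.ofReal_toReal h]⟩
  obtain ⟨η, hη, hηe⟩ : ∃ η : ℝ, 0 < η ∧ η * (4 + 3 * t / s) = 3 * s + t - 3 * u := by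
    have : 0 < 4 + 3 * t / s := by positivity
    refine ⟨(3 * s + t - 3 * u) / (4 + 3 * t / s), div_pos (by linarith) this, ?_⟩
    field_simp
  set q : ℝ := (1/2) ^ η with hq
  have hq0 : 0 < q := by positivity
  have hq1 : q < 1 := Real.rpow_lt_one (by norm_num) (by norm_num) hη
  have hqk : ∀ k : ℕ, q ^ k = ((1/2 : ℝ) ^ k) ^ η := by
    intro k
    rw [hq, ← Real.rpow_natCast, ← Real.rpow_natCast, ← Real.rpow_mul (by norm_num),
      ← Real.rpow_mul (by norm_num), mul_comm]
  have hq' : 0 < 1 - q := by linarith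
  set C1 := c * (1 - q) / 2 with hC1
  set C2 := c' * (1 - q) / 2 with hC2
  have hC10 : 0 < C1 := by positivity
  have hC20 : 0 < C2 := by positivity
  have hC11 : C1 ≤ 1 := by rw [hC1]; nlinarith
  set G := 8 / C1 ^ 3 * (50 * R ^ 3 / ((C1 / 4) ^ (1 / s) / 2) ^ 3) ^ t with hG
  have hG0 : 0 < G := by positivity
  obtain ⟨ε, hε0, hε1, hεG⟩ : ∃ ε : ℝ, 0 < ε ∧ ε ≤ 1 ∧ ε * G < C2 := by
    refine ⟨min 1 (C2 / (2 * G)), by positivity, min_le_left _ _, ?_⟩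
    calc min 1 (C2 / (2 * G)) * G ≤ C2 / (2 * G) * G := by gcongr; exact min_le_right _ _
      _ = C2 / 2 := by field_simp
      _ < C2 := by linarith
  obtain ⟨U, k, hFU, hUd, hsum⟩ := exists_cover hu hF hε0
  have hfin : ∀ m : ℕ, {n | k n = m}.Finite := by
    intro m
    have h1 := ENNReal.finite_const_le_of_tsum_ne_top (ne_top_of_le_ne_top ENNReal.ofReal_ne_top hsum)
      (ε := ENNReal.ofReal (((1/2 : ℝ) ^ m) ^ u)) (by
        rw [Ne, ENNReal.ofReal_eq_zero, not_le]; positivity)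
    refine h1.subset ?_
    intro n hn
    have hn' : k n = m := hn
    change ENNReal.ofReal (((1/2 : ℝ) ^ m) ^ u) ≤ ENNReal.ofReal (((1/2 : ℝ) ^ k n) ^ u)
    rw [hn']
  let I : ℕ → Finset ℕ := fun m => (hfin m).toFinset
  have hI : ∀ m n, n ∈ I m ↔ k n = m := by
    intro m n; simp [I]
  have hIcard : ∀ m, ((I m).card : ℝ) * ((1/2 : ℝ) ^ m) ^ u ≤ ε := by
    intro m
    have h1 := (ENNReal.sum_le_tsum (I m)).trans hsum
    rw [Finset.sum_congr rfl (g := fun _ => ENNReal.ofReal (((1/2 : ℝ) ^ m) ^ u))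
      (fun n hn => by rw [(hI m n).1 hn]), Finset.sum_const, nsmul_eq_mul,
      ← ENNReal.ofReal_natCast, ← ENNReal.ofReal_mul (by positivity),
      ENNReal.ofReal_le_ofReal_iff hε0.le] at h1
    exact h1
  let Km : ℕ → Set (EuclideanSpace ℝ (Fin 2) × ℝ) := fun m =>
    {p | p ∈ K ∧ ENNReal.ofReal (C1 * q ^ m) ≤ content s hs ((⋃ i ∈ I m, U i) ∩ sphere p.1 p.2)}
  have hKm : K ⊆ ⋃ m, Km m := by
    intro p hp
    have hsub : F ∩ sphere p.1 p.2 ⊆ ⋃ m, ((⋃ i ∈ I m, U i) ∩ sphere p.1 p.2) := by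
      rintro y ⟨hy, hy'⟩
      obtain ⟨n, hn⟩ := mem_iUnion.1 (hFU hy)
      refine mem_iUnion.2 ⟨k n, ?_, hy'⟩
      exact mem_iUnion₂.2 ⟨n, (hI _ _).2 rfl, hn⟩
    obtain ⟨m, hm⟩ := pigeon (content s hs) hsub hc hq0 hq1 (hKc p hp)
    exact mem_iUnion.2 ⟨m, hp, hm⟩
  obtain ⟨m, hm⟩ := pigeon (content t ht) hKm hc'0 hq0 hq1 hc'
  set δ : ℝ := (1/2) ^ m with hδ
  have hδ0 : 0 < δ := by positivity
  have hδ1 : δ ≤ 1 := pow_le_one₀ (by norm_num) (by norm_num)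
  have hb := scale_bound hs ht (I m) U (Km m) (δ := δ) (ρ := (C1 * δ ^ η / 4) ^ (1 / s) / 2)
    (c := C1 * δ ^ η) (R := R) hδ0 (hδ1.trans hR) (by positivity) (by positivity)
    (by
      rw [mul_div_cancel₀ _ (two_ne_zero), ← Real.rpow_mul (by positivity), one_div_mul_cancel hs.ne',
        Real.rpow_one]
      linarith)
    (by
      intro i hi
      have := hUd i
      rwa [(hI m i).1 hi] at this)
    (fun p hp => hK0 p hp.1) (fun p hp => hKR p hp.1)
    (by
      intro p hp
      rw [hδ, ← hqk]
      exact hp.2)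
  have hfinal := hm.trans hb
  rw [ENNReal.ofReal_le_ofReal_iff (by positivity), ← hC2, hqk] at hfinal
  have := numerics hs ht hη hηe hδ0 hδ1 hC10 hC11 hR (Nat.cast_nonneg _) (hIcard m) hfinal
  rw [← hG] at this
  have h3 : ε ^ 3 * G ≤ ε * G := by
    gcongr
    calc ε ^ 3 ≤ ε ^ 1 := pow_le_pow_of_le_one hε0.le hε1 (by norm_num)
      _ = ε := pow_one _
  linarith

end CircFurst

/-- **Dimension estimate for circular `(s,t)`-Furstenberg sets.**
If `F ⊆ ℝ²` is a circular `(s,t)`-Furstenberg set, i.e. there is a parameter set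
`K ⊆ ℝ² × (0,∞)` with `dim_H K ≥ t` such that `dim_H (F ∩ S(x,r)) ≥ s` for all `(x,r) ∈ K`,
then `dim_H F ≥ max {t/3 + s, (2s−1)t + s}`. -/
theorem circular_furstenberg_dim_lower_bound_one_third
    (s t : ℝ) (hs0 : 0 < s) (hs1 : s ≤ 1) (ht0 : 0 < t) (ht1 : t ≤ 1)
    (F : Set (EuclideanSpace ℝ (Fin 2)))
    (K : Set (EuclideanSpace ℝ (Fin 2) × ℝ))
    (hKpos : ∀ p ∈ K, 0 < p.2)
    (hKdim : ENNReal.ofReal t ≤ dimH K)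
    (hF : ∀ p ∈ K, ENNReal.ofReal s ≤ dimH (F ∩ Metric.sphere p.1 p.2)) :
    ENNReal.ofReal (t / 3 + s) ≤ dimH F := by
  by_contra! hlt
  obtain ⟨v, hv1, hv2⟩ := ENNReal.lt_iff_exists_nnreal_btwn.1 hlt
  have hu : (0:ℝ) < v := by
    have : (0 : ℝ≥0∞) < v := bot_le.trans_lt hv1
    exact_mod_cast this
  have hvr : (v : ℝ) < t / 3 + s := by
    rw [← ENNReal.ofReal_coe_nnreal] at hv2
    exact (ENNReal.ofReal_lt_ofReal_iff (by positivity)).1 hv2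
  have hF0 := CircFurst.content_zero_of_hausdorff_zero hu (hausdorffMeasure_of_dimH_lt hv1)
  obtain ⟨θ, hθ0, hθ1, hθ⟩ : ∃ θ : ℝ, 0 < θ ∧ θ < 1 ∧ (v : ℝ) < θ * (t / 3 + s) := by
    have hp : 0 < t / 3 + s := by positivity
    have h1 : (v : ℝ) / (t / 3 + s) < 1 := (div_lt_one hp).2 hvr
    obtain ⟨θ, h2, h3⟩ := exists_between h1
    exact ⟨θ, lt_trans (by positivity) h2, h3, (div_lt_iff₀ hp).1 h2⟩
  have hs' : 0 < θ * s := by positivity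
  have ht' : 0 < θ * t := by positivity
  have big : ∀ {X : Type} [EMetricSpace X] [MeasurableSpace X] [BorelSpace X] (A : Set X) (a : ℝ)
      (ha : 0 < a) (ha' : 0 < θ * a), ENNReal.ofReal a ≤ dimH A →
      CircFurst.content (θ * a) ha' A ≠ 0 := by
    intro X _ _ _ A a ha ha' h h0
    have h1 := CircFurst.hausdorff_zero_of_content_zero ha' h0
    have h2 : (((θ * a).toNNReal : NNReal) : ℝ≥0∞) < dimH A := by
      refine lt_of_lt_of_le ?_ h
      change ENNReal.ofReal (θ * a) < ENNReal.ofReal a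
      rw [ENNReal.ofReal_lt_ofReal_iff ha]
      nlinarith
    have h3 := hausdorffMeasure_of_lt_dimH h2
    rw [Real.coe_toNNReal _ ha'.le, h1] at h3
    exact ENNReal.zero_ne_top h3
  have hK' := big K t ht0 ht' hKdim
  let Km : ℕ → Set (EuclideanSpace ℝ (Fin 2) × ℝ) := fun m => {p | p ∈ K ∧ p.2 ≤ m + 1 ∧
    ENNReal.ofReal (1 / ((m : ℝ) + 1)) ≤ CircFurst.content (θ * s) hs' (F ∩ Metric.sphere p.1 p.2)}
  have hcov : K ⊆ ⋃ m, Km m := by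
    intro p hp
    have h1 := big _ s hs0 hs' (hF p hp)
    obtain ⟨b, hb0, hb⟩ : ∃ b : ℝ, 0 < b ∧ ENNReal.ofReal b ≤
        CircFurst.content (θ * s) hs' (F ∩ Metric.sphere p.1 p.2) := by
      rcases eq_or_ne (CircFurst.content (θ * s) hs' (F ∩ Metric.sphere p.1 p.2)) ∞ with h | h
      · exact ⟨1, one_pos, by rw [h]; exact le_top⟩
      · exact ⟨_, ENNReal.toReal_pos h1 h, by rw [ENNReal.ofReal_toReal h]⟩
    obtain ⟨m1, hm1⟩ := exists_nat_ge p.2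
    obtain ⟨m2, hm2⟩ := exists_nat_one_div_lt hb0
    refine mem_iUnion.2 ⟨max m1 m2, hp, ?_, ?_⟩
    · push_cast
      have := le_max_left (m1 : ℝ) m2
      linarith
    · refine le_trans (ENNReal.ofReal_le_ofReal ?_) hb
      refine le_trans ?_ hm2.le
      push_cast
      gcongr
      exact le_max_right _ _
  have hex : ∃ m, CircFurst.content (θ * t) ht' (Km m) ≠ 0 := by
    by_contra! h
    exact hK' (measure_mono_null hcov (measure_iUnion_null h))
  obtain ⟨m, hm⟩ := hex
  have hm0 : (0:ℝ) ≤ m := Nat.cast_nonneg m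
  exact CircFurst.core hs' ht' hu (by linarith) F (Km m) hF0 hm (R := m + 1) (c := 1 / ((m:ℝ) + 1))
    (by linarith) (by positivity) (by rw [div_le_one (by positivity)]; linarith)
    (fun p hp => hKpos p hp.1) (fun p hp => hp.2.1) (fun p hp => hp.2.2)
end

section
/- There exists an absolute constant K > 0 with the following property. Let A, B, C ∈ ℝ² be non-collinear points and c > 0 be such that min{‖A−B‖, ‖A−C‖, ‖B−C‖, 2} ≥ 2c, and let a > 0 satisfy a < c²/20. Let M ∈ ℝ² be the circumcenter of the triangle ABC, i.e., the unique point with ‖M−A‖ = ‖M−B‖ = ‖M−C‖. Then for every b ∈ [1/2, 2], the set W(b) := {x ∈ ℝ² : b−a ≤ ‖x−A‖ ≤ b+a, b−a ≤ ‖x−B‖ ≤ b+a, and b−a ≤ ‖x−C‖ ≤ b+a} is contained in the closed ball of center M and radius K·a/c². -/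
open scoped ENNReal
open MeasureTheory Metric Set

namespace ThreeAnnuli

abbrev E := EuclideanSpace ℝ (Fin 2)

/-- The planar determinant. -/
def dt (u v : E) : ℝ := u 0 * v 1 - u 1 * v 0

/-- The planar dot product. -/
def ip (u v : E) : ℝ := u 0 * v 0 + u 1 * v 1

lemma nsq (u : E) : ‖u‖ ^ 2 = u 0 ^ 2 + u 1 ^ 2 := by
  rw [EuclideanSpace.norm_sq_eq]; simp [Fin.sum_univ_two]

lemma dt_le (u v : E) : |dt u v| ≤ ‖u‖ * ‖v‖ := by
  apply abs_le_of_sq_le_sq _ (by positivity)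
  rw [mul_pow, nsq, nsq, dt]
  nlinarith [sq_nonneg (u 0 * v 0 + u 1 * v 1)]

lemma circ (P Q R : E) (b : ℝ) (hb : 0 ≤ b) (hP : ‖P‖ = b) (hQ : ‖Q‖ = b) (hR : ‖R‖ = b) :
    ‖P - Q‖ * ‖P - R‖ * ‖Q - R‖ = 2 * b * |dt (P - Q) (P - R)| := by
  have key : (‖P - Q‖ * ‖P - R‖ * ‖Q - R‖) ^ 2 = (2 * b * |dt (P - Q) (P - R)|) ^ 2 := by
    have h1 := nsq P
    have h2 := nsq Q
    have h3 := nsq R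
    rw [hP] at h1
    rw [hQ] at h2
    rw [hR] at h3
    simp only [mul_pow, sq_abs, nsq, dt, PiLp.sub_apply]
    rw [h1]
    obtain ⟨p, hp⟩ : ∃ p, p = P 0 := ⟨_, rfl⟩
    obtain ⟨q, hq⟩ : ∃ q, q = P 1 := ⟨_, rfl⟩
    obtain ⟨u, hu⟩ : ∃ u, u = P 0 - Q 0 := ⟨_, rfl⟩
    obtain ⟨u', hu'⟩ : ∃ u, u = P 1 - Q 1 := ⟨_, rfl⟩
    obtain ⟨v, hv⟩ : ∃ u, u = P 0 - R 0 := ⟨_, rfl⟩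
    obtain ⟨v', hv'⟩ : ∃ u, u = P 1 - R 1 := ⟨_, rfl⟩
    have e0 : Q 0 - R 0 = v - u := by rw [hu, hv]; ring
    have e1 : Q 1 - R 1 = v' - u' := by rw [hu', hv']; ring
    have hU : u ^ 2 + u' ^ 2 = 2 * (p * u + q * u') := by
      rw [hu, hu', hp, hq]; linarith
    have hV : v ^ 2 + v' ^ 2 = 2 * (p * v + q * v') := by
      rw [hv, hv', hp, hq]; linarith
    rw [e0, e1, ← hu, ← hu', ← hv, ← hv', ← hp, ← hq]
    have hW : (u ^ 2 + u' ^ 2) * (v ^ 2 + v' ^ 2) * ((v - u) ^ 2 + (v' - u') ^ 2)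
      = ((u ^ 2 + u' ^ 2) * v - (v ^ 2 + v' ^ 2) * u) ^ 2
        + ((u ^ 2 + u' ^ 2) * v' - (v ^ 2 + v' ^ 2) * u') ^ 2 := by ring
    rw [hW, hU, hV]; ring
  exact (sq_eq_sq₀ (by positivity) (by positivity)).1 key

lemma solve (m u v : E) (t : ℝ) (hu : |ip m u| ≤ t) (hv : |ip m v| ≤ t) :
    ‖m‖ * |dt u v| ≤ t * (‖u‖ + ‖v‖) := by
  have ht : 0 ≤ t := (abs_nonneg _).trans hu
  apply abs_le_of_sq_le_sq' _ (by positivity) |>.2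
  have h : (‖m‖ * |dt u v|) ^ 2
      = (ip m u) ^ 2 * ‖v‖ ^ 2 + (ip m v) ^ 2 * ‖u‖ ^ 2 - 2 * (ip m u * ip m v * ip u v) := by
    simp only [mul_pow, sq_abs, nsq, dt, ip]; ring
  have hi : |ip u v| ≤ ‖u‖ * ‖v‖ := by
    apply abs_le_of_sq_le_sq _ (by positivity)
    rw [mul_pow, nsq, nsq, ip]
    nlinarith [sq_nonneg (u 0 * v 1 - u 1 * v 0)]
  have h3 : |ip m u * ip m v * ip u v| ≤ t * t * (‖u‖ * ‖v‖) := by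
    rw [abs_mul, abs_mul]; gcongr
  have h1 : (ip m u) ^ 2 ≤ t ^ 2 := by rw [← sq_abs]; gcongr
  have h2 : (ip m v) ^ 2 ≤ t ^ 2 := by rw [← sq_abs]; gcongr
  rw [h]
  nlinarith [mul_le_mul_of_nonneg_right h1 (sq_nonneg ‖v‖),
    mul_le_mul_of_nonneg_right h2 (sq_nonneg ‖u‖), (abs_le.1 h3).1]

lemma pert (P : E) (a b : ℝ) (hb : 0 ≤ b) (hP : 0 < ‖P‖) (h1 : b - a ≤ ‖P‖) (h2 : ‖P‖ ≤ b + a) :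
    ∃ P' : E, ‖P'‖ = b ∧ ‖P' - P‖ ≤ a := by
  refine ⟨(b / ‖P‖) • P, ?_, ?_⟩
  · rw [norm_smul, Real.norm_of_nonneg (by positivity)]; field_simp
  · have : (b / ‖P‖) • P - P = (b / ‖P‖ - 1) • P := by rw [sub_smul, one_smul]
    rw [this, norm_smul, Real.norm_eq_abs]
    have : |b / ‖P‖ - 1| * ‖P‖ = |b - ‖P‖| := by
      rw [← abs_of_pos hP, ← abs_mul, abs_of_pos hP]; congr 1; field_simp
    rw [this, abs_le]; constructor <;> linarith

lemma half (m P Q : E) (a b : ℝ) (_ha : 0 ≤ a) (hb : b ≤ 2) (hba : a ≤ b)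
    (hP : b - a ≤ ‖P‖ ∧ ‖P‖ ≤ b + a) (hQ : b - a ≤ ‖Q‖ ∧ ‖Q‖ ≤ b + a)
    (h : ‖m - P‖ = ‖m - Q‖) : |ip m (P - Q)| ≤ 4 * a := by
  have h' : ‖m - P‖ ^ 2 = ‖m - Q‖ ^ 2 := by rw [h]
  have e : 2 * ip m (P - Q) = ‖P‖ ^ 2 - ‖Q‖ ^ 2 := by
    simp only [nsq, ip, PiLp.sub_apply] at h' ⊢
    linarith
  rw [abs_le]
  constructor <;> nlinarith [norm_nonneg P, norm_nonneg Q]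

lemma main (P Q R m : E) (c a b : ℝ) (hc : 0 < c) (hc1 : c ≤ 1) (ha : 0 < a)
    (hac : a < c ^ 2 / 20) (hb1 : 1 / 2 ≤ b) (hb : b ≤ 2)
    (hPQ : 2 * c ≤ ‖P - Q‖) (hPR : 2 * c ≤ ‖P - R‖) (hQR : 2 * c ≤ ‖Q - R‖)
    (hP : b - a ≤ ‖P‖ ∧ ‖P‖ ≤ b + a) (hQ : b - a ≤ ‖Q‖ ∧ ‖Q‖ ≤ b + a)
    (hR : b - a ≤ ‖R‖ ∧ ‖R‖ ≤ b + a)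
    (h1 : ‖m - P‖ = ‖m - Q‖) (h2 : ‖m - P‖ = ‖m - R‖) : ‖m‖ ≤ 20 * a / c ^ 2 := by
  have hac' : a ≤ c / 20 := by nlinarith
  have hab : a < b := by linarith
  obtain ⟨P', hP', dP⟩ := pert P a b (by linarith) (by linarith) hP.1 hP.2
  obtain ⟨Q', hQ', dQ⟩ := pert Q a b (by linarith) (by linarith) hQ.1 hQ.2
  obtain ⟨R', hR', dR⟩ := pert R a b (by linarith) (by linarith) hR.1 hR.2
  have diff : ∀ X Y X' Y' : E, ‖X' - X‖ ≤ a → ‖Y' - Y‖ ≤ a →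
      ‖(X' - Y') - (X - Y)‖ ≤ 2 * a := by
    intro X Y X' Y' hX hY
    have : (X' - Y') - (X - Y) = (X' - X) - (Y' - Y) := by abel
    rw [this]
    linarith [norm_sub_le (X' - X) (Y' - Y)]
  have du := diff P Q P' Q' dP dQ
  have dv := diff P R P' R' dP dR
  have dw := diff Q R Q' R' dQ dR
  have hs := solve m (P - Q) (P - R) (4 * a) (half m P Q a b ha.le hb hab.le hP hQ h1)
    (half m P R a b ha.le hb hab.le hP hR h2)
  have hcirc := circ P' Q' R' b (by linarith) hP' hQ' hR'
  generalize P - Q = u at *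
  generalize P - R = v at *
  generalize Q - R = w at *
  generalize P' - Q' = u' at *
  generalize P' - R' = v' at *
  generalize Q' - R' = w' at *
  have nu : ‖u‖ - 2 * a ≤ ‖u'‖ := by
    have := norm_sub_norm_le u u'
    rw [norm_sub_rev] at this; linarith
  have nu2 : ‖u'‖ ≤ ‖u‖ + 2 * a := by
    have := norm_sub_norm_le u' u
    linarith
  have nv : ‖v‖ - 2 * a ≤ ‖v'‖ := by
    have := norm_sub_norm_le v v'
    rw [norm_sub_rev] at this; linarith
  have nw : ‖w‖ - 2 * a ≤ ‖w'‖ := by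
    have := norm_sub_norm_le w w'
    rw [norm_sub_rev] at this; linarith
  have hdd : dt u' v' = dt u v + dt (u' - u) v + dt u' (v' - v) := by
    simp only [dt, PiLp.sub_apply]; ring
  have hd1 : |dt u' v'| ≤ |dt u v| + 2 * a * ‖v‖ + ‖u'‖ * (2 * a) := by
    rw [hdd]
    have e1 := dt_le (u' - u) v
    have e2 := dt_le u' (v' - v)
    have e3 : ‖u' - u‖ * ‖v‖ ≤ 2 * a * ‖v‖ := by gcongr
    have e4 : ‖u'‖ * ‖v' - v‖ ≤ ‖u'‖ * (2 * a) := by gcongr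
    linarith [abs_add_le (dt u v + dt (u' - u) v) (dt u' (v' - v)),
      abs_add_le (dt u v) (dt (u' - u) v)]
  have nu3 : 0.95 * ‖u‖ ≤ ‖u'‖ := by linarith
  have nu4 : ‖u'‖ ≤ 1.05 * ‖u‖ := by linarith
  have nv3 : 0.95 * ‖v‖ ≤ ‖v'‖ := by linarith
  have nw3 : 1.9 * c ≤ ‖w'‖ := by linarith
  have hd2 : (0.95 * ‖u‖) * (0.95 * ‖v‖) * (1.9 * c) ≤ 4 * |dt u' v'| := by
    calc (0.95 * ‖u‖) * (0.95 * ‖v‖) * (1.9 * c) ≤ ‖u'‖ * ‖v'‖ * ‖w'‖ := by gcongr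
      _ = 2 * b * |dt u' v'| := hcirc
      _ ≤ 4 * |dt u' v'| := by
        have := abs_nonneg (dt u' v')
        nlinarith
  have hu0 := norm_nonneg u
  have hv0 := norm_nonneg v
  generalize ‖u‖ = x at *
  generalize ‖v‖ = y at *
  have cy : 2 * c * y ≤ x * y := by gcongr
  have cx : 2 * c * x ≤ x * y := by rw [mul_comm x y]; gcongr
  have f1 : a * y ≤ c ^ 2 / 20 * y := by gcongr
  have f2 : a * ‖u'‖ ≤ c ^ 2 / 20 * (1.05 * x) := by gcongr
  have f3 : c * (2 * c * y) ≤ c * (x * y) := by gcongr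
  have f4 : c * (2 * c * x) ≤ c * (x * y) := by gcongr
  have hd3 : 0.2 * (c * (x * y)) ≤ |dt u v| := by
    have f5 : 0 ≤ c * (x * y) := by positivity
    linarith
  have hxy : 0 < x * y := by
    have : 0 < x := by linarith
    have : 0 < y := by linarith
    positivity
  have g1 : ‖m‖ * (0.2 * (c * (x * y))) ≤ 4 * a * (x + y) :=
    le_trans (by gcongr) hs
  have g2 : c * (4 * a * (x + y)) ≤ 4 * a * (x * y) := by
    have := mul_le_mul_of_nonneg_left (add_le_add cx cy) ha.le
    linarith
  have g3 : c * (‖m‖ * (0.2 * (c * (x * y)))) ≤ c * (4 * a * (x + y)) := by gcongr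
  rw [le_div_iff₀ (by positivity)]
  have g4 : (‖m‖ * c ^ 2) * (x * y) ≤ (20 * a) * (x * y) := by linarith
  exact le_of_mul_le_mul_right g4 hxy

end ThreeAnnuli

/-- **Non-degenerate case of the three-annuli lemma.** There is an absolute constant `K > 0`
such that: if `A, B, C ∈ ℝ²` are non-collinear, `min {‖A−B‖, ‖A−C‖, ‖B−C‖, 2} ≥ 2c`,
`0 < a < c²/20`, and `M` is the circumcenter of `△ABC` (the unique point equidistant from
`A`, `B` and `C`), then for every `b ∈ [1/2, 2]` the intersection `W(b)` of the three closed
annuli of radii `[b−a, b+a]` centered at `A`, `B`, `C` is contained in the closed ball of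
center `M` and radius `K·a/c²`. -/
theorem three_annuli_subset_ball_of_circumcenter :
    ∃ K : ℝ, 0 < K ∧
      ∀ (A B C M : EuclideanSpace ℝ (Fin 2)) (c a : ℝ),
        ¬ Collinear ℝ ({A, B, C} : Set (EuclideanSpace ℝ (Fin 2))) →
        0 < c →
        2 * c ≤ min (min (‖A - B‖) (‖A - C‖)) (min (‖B - C‖) 2) →
        0 < a → a < c ^ 2 / 20 →
        ‖M - A‖ = ‖M - B‖ → ‖M - A‖ = ‖M - C‖ →
        ∀ b ∈ Set.Icc (1 / 2 : ℝ) 2,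
          {x : EuclideanSpace ℝ (Fin 2) |
              (b - a ≤ ‖x - A‖ ∧ ‖x - A‖ ≤ b + a) ∧
              (b - a ≤ ‖x - B‖ ∧ ‖x - B‖ ≤ b + a) ∧
              (b - a ≤ ‖x - C‖ ∧ ‖x - C‖ ≤ b + a)} ⊆
            Metric.closedBall M (K * a / c ^ 2) := by
  refine ⟨20, by norm_num, ?_⟩
  intro A B C M c a _ hc hmin ha hac h1 h2 b hb x hx
  obtain ⟨hA, hB, hC⟩ := hx
  simp only [le_min_iff] at hmin
  obtain ⟨⟨hAB, hAC⟩, hBC, h22⟩ := hmin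
  rw [Metric.mem_closedBall, dist_comm, dist_eq_norm]
  rw [norm_sub_rev x] at hA hB hC
  have e : ∀ X Y : EuclideanSpace ℝ (Fin 2), (X - x) - (Y - x) = X - Y := fun X Y => by abel
  exact ThreeAnnuli.main (A - x) (B - x) (C - x) (M - x) c a b hc (by linarith) ha hac hb.1 hb.2
    (by rwa [e]) (by rwa [e]) (by rwa [e]) hA hB hC (by rwa [e, e]) (by rwa [e, e])
end
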